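/- arXiv:1905.05165 — 5 statements merged into one kernel-verified Lean document; each statement's English description precedes it below -/
import Mathlib

section
/- Let A ⊆ ℝ^ℓ be a nonempty set that is upward closed, i.e., z ∈ A and z' ≥ z (componentwise) imply z' ∈ A, and let ν ∈ ℝ^ℓ with ν ∉ cvh(A). Then there exists a vector p in the standard simplex Δ = {p ∈ ℝ^ℓ : p ≥ 0, Σ_j p_j = 1} such that pᵀν ≤ pᵀz for every z ∈ cvh(A). -/
open scoped BigOperators

/-- A nonempty upward-closed subset of `ℝ^ℓ` has nonempty interior. -/
theorem interior_nonempty_of_upward_closed {ℓ : ℕ} {A : Set (EuclideanSpace ℝ (Fin ℓ))}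
    (hA : A.Nonempty)
    (hup : ∀ z ∈ A, ∀ z' : EuclideanSpace ℝ (Fin ℓ), (∀ j, z j ≤ z' j) → z' ∈ A) :
    (interior A).Nonempty := by
  obtain ⟨z, hz⟩ := hA
  have hopen : IsOpen {x : EuclideanSpace ℝ (Fin ℓ) | ∀ j, z j < x j} := by
    simp only [Set.ofPred_forall]
    exact isOpen_iInter_of_finite fun j => isOpen_lt (by fun_prop) (by fun_prop)
  refine ⟨WithLp.toLp 2 fun j => z j + 1, interior_maximal ?_ hopen ?_⟩
  · exact fun x hx => hup z hz x fun j => (hx j).le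
  · intro j
    simp

/-- A linear functional on `ℝ^ℓ` is determined by its values on the coordinate vectors. -/
theorem apply_eq_sum_single {ℓ : ℕ} (f : StrongDual ℝ (EuclideanSpace ℝ (Fin ℓ)))
    (x : EuclideanSpace ℝ (Fin ℓ)) :
    f x = ∑ j, f (EuclideanSpace.single j 1) * x j := by
  conv_lhs => rw [← (EuclideanSpace.basisFun (Fin ℓ) ℝ).sum_repr x]
  simp [mul_comm]

/-- A linear functional bounded above on a nonempty upward-closed set is nonpositive on the
coordinate vectors. -/
theorem apply_single_nonpos_of_upward_closed {ℓ : ℕ} {A : Set (EuclideanSpace ℝ (Fin ℓ))}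
    (hA : A.Nonempty)
    (hup : ∀ z ∈ A, ∀ z' : EuclideanSpace ℝ (Fin ℓ), (∀ j, z j ≤ z' j) → z' ∈ A)
    (f : StrongDual ℝ (EuclideanSpace ℝ (Fin ℓ))) {c : ℝ} (hf : ∀ a ∈ A, f a ≤ c)
    (j : Fin ℓ) : f (EuclideanSpace.single j 1) ≤ 0 := by
  obtain ⟨z, hz⟩ := hA
  by_contra! hpos
  set t := (c - f z + 1) / f (EuclideanSpace.single j 1) with ht
  have ht0 : 0 ≤ t := div_nonneg (by linarith [hf z hz]) hpos.le
  have hmem : z + t • EuclideanSpace.single j (1 : ℝ) ∈ A := by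
    refine hup z hz _ fun i => ?_
    by_cases hij : i = j <;> simp [hij, ht0]
  have hle := hf _ hmem
  rw [map_add, map_smul, smul_eq_mul, ht, div_mul_cancel₀ _ hpos.ne'] at hle
  linarith

/-- **Separation by a simplex price vector.** A point outside the convex hull of a
nonempty upward-closed set `A ⊆ ℝ^ℓ` can be weakly separated from `cvh(A)` by a
nonnegative, normalized price vector `p` in the standard simplex. -/
theorem separation_upward_closed
    (ℓ : ℕ) (A : Set (EuclideanSpace ℝ (Fin ℓ))) (hA : A.Nonempty)
    (hup : ∀ z ∈ A, ∀ z' : EuclideanSpace ℝ (Fin ℓ), (∀ j, z j ≤ z' j) → z' ∈ A)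
    (ν : EuclideanSpace ℝ (Fin ℓ)) (hν : ν ∉ convexHull ℝ A) :
    ∃ p : EuclideanSpace ℝ (Fin ℓ), (∀ j, 0 ≤ p j) ∧ (∑ j, p j) = 1 ∧
      ∀ z ∈ convexHull ℝ A, (∑ j, p j * ν j) ≤ (∑ j, p j * z j) := by
  obtain ⟨f, hf0, hf⟩ := geometric_hahn_banach_of_nonempty_interior_point
    (convex_convexHull ℝ A) (fun h => hν (interior_subset h))
    ((interior_nonempty_of_upward_closed hA hup).mono
      (interior_mono (subset_convexHull ℝ A)))
  have hneg := apply_single_nonpos_of_upward_closed hA hup f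
    fun a ha => hf a (subset_convexHull ℝ A ha)
  set S := ∑ j, f (EuclideanSpace.single j 1) with hS
  have hSneg : S < 0 := by
    refine lt_of_le_of_ne (Finset.sum_nonpos fun j _ => hneg j) fun h => hf0 ?_
    have hzero := (Finset.sum_eq_zero_iff_of_nonpos fun j _ => hneg j).1 h
    ext x
    rw [apply_eq_sum_single f x]
    exact Finset.sum_eq_zero fun j hj => by rw [hzero j hj, zero_mul]
  have hsum (x : EuclideanSpace ℝ (Fin ℓ)) :
      ∑ j, f (EuclideanSpace.single j 1) / S * x j = f x / S := by
    rw [apply_eq_sum_single f x, Finset.sum_div]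
    exact Finset.sum_congr rfl fun j _ => by ring
  refine ⟨WithLp.toLp 2 fun j => f (EuclideanSpace.single j 1) / S,
    fun j => div_nonneg_of_nonpos (hneg j) hSneg.le, ?_, fun z hz => ?_⟩
  · change ∑ j, f (EuclideanSpace.single j 1) / S = 1
    rw [← Finset.sum_div, ← hS, div_self hSneg.ne]
  · change ∑ j, f (EuclideanSpace.single j 1) / S * ν j ≤
      ∑ j, f (EuclideanSpace.single j 1) / S * z j
    rw [hsum, hsum]
    exact div_le_div_of_nonpos_of_le hSneg.le (hf z hz)
end

section
/- Let E = ((u_i, ω_i))_{i∈[h]} be an exchange economy with strictly monotone increasing continuous utilities, let ȳ = (ȳ_i)_{i∈[h]} be an allocation of E, set δ = ε/h, and for each i let Q_i = {z ∈ ℝ^ℓ : z + ω_i ∈ ℝ^ℓ_+ and u_i(z + ω_i) ≥ u_i(ȳ_i)}. Suppose p ∈ Δ satisfies pᵀ((−δ)·𝟏) ≤ pᵀz for every z ∈ ⋃_{i=1}^h Q_i. Then (p, ȳ) is an ε-Walrasian equilibrium: for every consumer i, (i) |pᵀȳ_i − pᵀω_i| ≤ (h−1)δ ≤ ε, and (ii)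 every bundle y ∈ ℝ^ℓ_+ with u_i(y) ≥ u_i(ȳ_i) satisfies pᵀy ≥ pᵀω_i − δ. -/
open scoped BigOperators

/-- **Separating prices yield an ε-Walrasian equilibrium** (the final step of the proofs of
Theorem 2 and Lemma 4): if `p ∈ Δ` satisfies `pᵀ((-δ)𝟏) ≤ pᵀz` for every trade `z` in
every upper-contour trade set `Q_i` (with `δ = ε/h`), then for every consumer `i`:
(i) `|pᵀȳ_i − pᵀω_i| ≤ (h−1)δ ≤ ε`, and (ii) every bundle `y ≥ 0` with
`u_i(y) ≥ u_i(ȳ_i)` satisfies `pᵀy ≥ pᵀω_i − δ`. -/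
theorem separating_price_walrasian
    (ℓ h : ℕ) (hh : 0 < h)
    (u : Fin h → EuclideanSpace ℝ (Fin ℓ) → ℝ)
    (ω : Fin h → EuclideanSpace ℝ (Fin ℓ))
    (hω : ∀ i j, 0 ≤ ω i j)
    (hmono : ∀ i, ∀ x y : EuclideanSpace ℝ (Fin ℓ),
      (∀ j, 0 ≤ x j) → (∀ j, x j ≤ y j) → x ≠ y → u i x < u i y)
    (hcont : ∀ i, Continuous (u i))
    (ε : ℝ) (hε : 0 < ε) (δ : ℝ) (hδ : δ = ε / h)
    -- the allocation `ȳ`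
    (ybar : Fin h → EuclideanSpace ℝ (Fin ℓ))
    (hybar_nonneg : ∀ i j, 0 ≤ ybar i j)
    (hybar_alloc : (∑ i, ybar i) = (∑ i, ω i))
    -- the price vector `p ∈ Δ`
    (p : EuclideanSpace ℝ (Fin ℓ)) (hp_nonneg : ∀ j, 0 ≤ p j) (hp_sum : (∑ j, p j) = 1)
    -- `p` separates `(-δ)·𝟏` from `⋃ᵢ Q_i`
    (hsep : ∀ i, ∀ z : EuclideanSpace ℝ (Fin ℓ), (∀ j, 0 ≤ z j + ω i j) →
      u i (z + ω i) ≥ u i (ybar i) → (∑ j, p j * (-δ)) ≤ (∑ j, p j * z j)) :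
    ∀ i,
      (|(∑ j, p j * ybar i j) - (∑ j, p j * ω i j)| ≤ (h - 1 : ℝ) * δ ∧
        (h - 1 : ℝ) * δ ≤ ε) ∧
      (∀ y : EuclideanSpace ℝ (Fin ℓ), (∀ j, 0 ≤ y j) →
        u i y ≥ u i (ybar i) → (∑ j, p j * y j) ≥ (∑ j, p j * ω i j) - δ) := by
  have hh0 : (0 : ℝ) < h := by exact_mod_cast hh
  have hδ0 : 0 < δ := by rw [hδ]; positivity
  have hhδ : (h : ℝ) * δ = ε := by rw [hδ]; field_simp
  have hsupp : ∀ i, ∀ y : EuclideanSpace ℝ (Fin ℓ), (∀ j, 0 ≤ y j) →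
      u i y ≥ u i (ybar i) → (∑ j, p j * y j) ≥ (∑ j, p j * ω i j) - δ := by
    intro i y hy hu
    have key := hsep i (y - ω i) (fun j => by simpa using hy j) (by simpa using hu)
    simp only [PiLp.sub_apply, mul_sub, Finset.sum_sub_distrib, ← Finset.sum_mul, hp_sum] at key
    linarith
  set d : Fin h → ℝ := fun i => (∑ j, p j * ybar i j) - ∑ j, p j * ω i j with hd
  have hd_lower : ∀ i, -δ ≤ d i := fun i => by
    have := hsupp i (ybar i) (hybar_nonneg i) le_rfl
    simp only [hd]
    linarith
  have hd_sum : ∑ i, d i = 0 := by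
    have hgood : ∀ j, ∑ i, ybar i j = ∑ i, ω i j := fun j => by
      simpa using congrArg (fun x : EuclideanSpace ℝ (Fin ℓ) => x j) hybar_alloc
    simp only [hd, Finset.sum_sub_distrib]
    rw [Finset.sum_comm, Finset.sum_comm (f := fun i j => p j * ω i j)]
    simp [← Finset.mul_sum, hgood]
  intro i
  have hsplit : d i + ∑ k ∈ Finset.univ.erase i, d k = 0 := by
    rw [Finset.add_sum_erase _ _ (Finset.mem_univ i), hd_sum]
  have hrest : -((h - 1 : ℝ) * δ) ≤ ∑ k ∈ Finset.univ.erase i, d k := by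
    have := Finset.card_nsmul_le_sum (Finset.univ.erase i) d (-δ) fun k _ => hd_lower k
    simpa [Finset.card_erase_of_mem, Nat.cast_sub (Nat.one_le_of_lt hh)] using this
  refine ⟨⟨abs_le.mpr ⟨?_, ?_⟩, by linarith⟩, hsupp i⟩
  · change _ ≤ d i
    rcases Nat.lt_or_ge 1 h with h2 | h1
    · have : (2 : ℝ) ≤ h := by exact_mod_cast h2
      nlinarith [hd_lower i]
    · obtain rfl : h = 1 := by omega
      have : d i = 0 := by rwa [Fin.sum_univ_one, ← Subsingleton.elim i 0] at hd_sum
      simp [this]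
  · change d i ≤ _
    linarith
end

section
/- Let E = ((u_t, ω_t))_{t∈[h]} be an exchange economy in which every utility u_t is strictly monotone increasing, continuous, and strictly concave, and let Eⁿ be its n-th replica economy. Then every allocation x̄ = (x̄_{i,t})_{(i,t)∈[n]×[h]} in the h-core of Eⁿ satisfies the equal treatment property: x̄_{i,t} = x̄_{i',t} for every type t ∈ [h] and all indices i, i' ∈ [n]. -/
open scoped BigOperators

/-- A minimum of finitely many values of a concave function is at most its value at the
barycenter. -/
lemma ConcaveOn.le_map_barycenter {E ι : Type*} [AddCommGroup E] [Module ℝ E] [Fintype ι]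
    [Nonempty ι] {s : Set E} {f : E → ℝ} (hf : ConcaveOn ℝ s f) {p : ι → E}
    (hp : ∀ i, p i ∈ s) {b : ℝ} (hb : ∀ i, b ≤ f (p i)) :
    b ≤ f (∑ i, (Fintype.card ι : ℝ)⁻¹ • p i) := by
  have hw : ∑ _i : ι, (Fintype.card ι : ℝ)⁻¹ = 1 := by simp
  calc b = ∑ _i : ι, (Fintype.card ι : ℝ)⁻¹ • b := by rw [← Finset.sum_smul, hw, one_smul]
    _ ≤ ∑ i, (Fintype.card ι : ℝ)⁻¹ • f (p i) :=
        Finset.sum_le_sum fun i _ => smul_le_smul_of_nonneg_left (hb i) (by positivity)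
    _ ≤ _ := hf.le_map_sum (fun _ _ => by positivity) hw fun i _ => hp i

/-- For a strictly concave function and points that are not all equal, the value at the
barycenter exceeds every lower bound of the values at the points. -/
lemma StrictConcaveOn.lt_map_barycenter {E ι : Type*} [AddCommGroup E] [Module ℝ E] [Fintype ι]
    {s : Set E} {f : E → ℝ} (hf : StrictConcaveOn ℝ s f) {p : ι → E}
    (hp : ∀ i, p i ∈ s) {b : ℝ} (hb : ∀ i, b ≤ f (p i)) {j k : ι} (hjk : p j ≠ p k) :
    b < f (∑ i, (Fintype.card ι : ℝ)⁻¹ • p i) := by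
  have : Nonempty ι := ⟨j⟩
  have hw : ∑ _i : ι, (Fintype.card ι : ℝ)⁻¹ = 1 := by simp
  calc b = ∑ _i : ι, (Fintype.card ι : ℝ)⁻¹ • b := by rw [← Finset.sum_smul, hw, one_smul]
    _ ≤ ∑ i, (Fintype.card ι : ℝ)⁻¹ • f (p i) :=
        Finset.sum_le_sum fun i _ => smul_le_smul_of_nonneg_left (hb i) (by positivity)
    _ < _ := hf.lt_map_sum (fun _ _ => by positivity) hw (fun i _ => hp i)
        ⟨j, Finset.mem_univ j, k, Finset.mem_univ k, hjk⟩

/-- If a continuous function exceeds `b` at `a`, it still does so at a slightly shrunk copy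
of `a`. -/
lemma Continuous.exists_lt_map_smul {E : Type*} [TopologicalSpace E] [AddCommGroup E]
    [Module ℝ E] [ContinuousSMul ℝ E] {f : E → ℝ} (hf : Continuous f) {a : E} {b : ℝ}
    (hb : b < f a) : ∃ ε : ℝ, 0 < ε ∧ ε < 1 ∧ b < f ((1 - ε) • a) := by
  have hg : Continuous fun ε : ℝ => f ((1 - ε) • a) := by fun_prop
  have h0 : ∀ᶠ ε in nhdsWithin (0 : ℝ) (Set.Ioi 0), b < f ((1 - ε) • a) :=
    hg.continuousWithinAt.eventually (lt_mem_nhds (by simpa using hb))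
  have h1 : ∀ᶠ ε in nhdsWithin (0 : ℝ) (Set.Ioi 0), ε < 1 :=
    nhdsWithin_le_nhds (gt_mem_nhds one_pos)
  obtain ⟨ε, h, h', hpos⟩ :=
    (h0.and (h1.and self_mem_nhdsWithin)).exists
  exact ⟨ε, hpos, h', h⟩

/-- **Lemma 1 (equal treatment property).** If all utilities are strictly monotone
increasing, continuous and strictly concave, then every allocation in the `h`-core of the
`n`-th replica economy gives identical bundles to all consumers of the same type. -/
theorem equal_treatment
    (ℓ h n : ℕ)
    (u : Fin h → EuclideanSpace ℝ (Fin ℓ) → ℝ)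
    (ω : Fin h → EuclideanSpace ℝ (Fin ℓ))
    (hω : ∀ t j, 0 ≤ ω t j)
    (hmono : ∀ t, ∀ x y : EuclideanSpace ℝ (Fin ℓ),
      (∀ j, 0 ≤ x j) → (∀ j, x j ≤ y j) → x ≠ y → u t x < u t y)
    (hcont : ∀ t, Continuous (u t))
    (hconc : ∀ t, StrictConcaveOn ℝ {x : EuclideanSpace ℝ (Fin ℓ) | ∀ j, 0 ≤ x j} (u t))
    -- an allocation of the replica economy `Eⁿ`
    (xbar : Fin n × Fin h → EuclideanSpace ℝ (Fin ℓ))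
    (hxbar_nonneg : ∀ c j, 0 ≤ xbar c j)
    (hxbar_alloc : (∑ c : Fin n × Fin h, xbar c) = (∑ c : Fin n × Fin h, ω c.2))
    -- `xbar` lies in the `h`-core of `Eⁿ`
    (hcore : ∀ S : Finset (Fin n × Fin h), S.Nonempty → S.card ≤ h →
      ¬ ∃ y : Fin n × Fin h → EuclideanSpace ℝ (Fin ℓ),
          (∀ c ∈ S, ∀ j, 0 ≤ y c j) ∧
          (∑ c ∈ S, y c) = (∑ c ∈ S, ω c.2) ∧
          (∀ c ∈ S, u c.2 (xbar c) < u c.2 (y c))) :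
    ∀ t : Fin h, ∀ i i' : Fin n, xbar (i, t) = xbar (i', t) := by
  classical
  intro t₀ i i'
  by_contra hne
  have : Nonempty (Fin n) := ⟨i⟩
  have : Nonempty (Fin h) := ⟨t₀⟩
  have hn : (n : ℝ) ≠ 0 := Nat.cast_ne_zero.mpr (Fin.pos i).ne'
  have hh : (0 : ℝ) < h := Nat.cast_pos.mpr (Fin.pos t₀)
  choose m hm using fun t => Finite.exists_min fun k : Fin n => u t (xbar (k, t))
  set a : Fin h → EuclideanSpace ℝ (Fin ℓ) :=
    fun t => ∑ k : Fin n, (Fintype.card (Fin n) : ℝ)⁻¹ • xbar (k, t) with ha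
  have ha_nonneg : ∀ t j, 0 ≤ a t j := by
    intro t j
    simp only [ha, WithLp.ofLp_sum, Finset.sum_apply, PiLp.smul_apply, smul_eq_mul]
    exact Finset.sum_nonneg fun k _ => mul_nonneg (by positivity) (hxbar_nonneg _ j)
  have ha_sum : ∑ t, a t = ∑ t, ω t := by
    rw [Fintype.sum_prod_type_right, Fintype.sum_prod_type] at hxbar_alloc
    simp only [ha, ← Finset.smul_sum, hxbar_alloc, Finset.sum_const, Finset.card_univ,
      Fintype.card_fin]
    rw [← Nat.cast_smul_eq_nsmul ℝ, smul_smul, inv_mul_cancel₀ hn, one_smul]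
  have ha_le : ∀ t, u t (xbar (m t, t)) ≤ u t (a t) := fun t =>
    (hconc t).concaveOn.le_map_barycenter (p := fun k => xbar (k, t)) (fun k => hxbar_nonneg (k, t)) (hm t)
  have ha_lt : u t₀ (xbar (m t₀, t₀)) < u t₀ (a t₀) :=
    (hconc t₀).lt_map_barycenter (p := fun k => xbar (k, t₀)) (fun k => hxbar_nonneg (k, t₀)) (hm t₀) hne
  obtain ⟨ε, hε, hε1, hlt⟩ := (hcont t₀).exists_lt_map_smul ha_lt
  have ha_ne : a t₀ ≠ 0 := by
    intro h0
    rw [h0, smul_zero, ← h0] at hlt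
    have hx : ∀ k, xbar (k, t₀) = 0 := by
      intro k
      ext j
      have hj : ∑ k : Fin n, (Fintype.card (Fin n) : ℝ)⁻¹ * xbar (k, t₀) j = 0 := by
        simpa [ha] using congrArg (fun v : EuclideanSpace ℝ (Fin ℓ) => v j) h0
      have := (Finset.sum_eq_zero_iff_of_nonneg fun k _ =>
        mul_nonneg (by positivity) (hxbar_nonneg (k, t₀) j)).mp hj k (Finset.mem_univ k)
      simpa [hn] using this
    exact hne ((hx i).trans (hx i').symm)
  -- The type `t₀` gives up the fraction `ε` of its average bundle, to be shared by all types.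
  set b : Fin h → EuclideanSpace ℝ (Fin ℓ) :=
    fun t => if t = t₀ then (1 - ε) • a t₀ else a t with hb
  set g : EuclideanSpace ℝ (Fin ℓ) := (ε / h) • a t₀ with hg
  have hg_nonneg : ∀ j, 0 ≤ g j := fun j => by
    simpa [hg] using mul_nonneg (by positivity) (ha_nonneg t₀ j)
  have hg_ne : g ≠ 0 := smul_ne_zero (by positivity) ha_ne
  have hb_nonneg : ∀ t j, 0 ≤ b t j := by
    intro t j
    by_cases ht : t = t₀
    · simpa [hb, ht] using mul_nonneg (sub_nonneg.mpr hε1.le) (ha_nonneg t₀ j)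
    · simpa [hb, ht] using ha_nonneg t j
  have hb_le : ∀ t, u t (xbar (m t, t)) ≤ u t (b t) := by
    intro t
    by_cases ht : t = t₀
    · subst ht
      simpa [hb] using hlt.le
    · simpa [hb, ht] using ha_le t
  have hb_sum : ∑ t, (b t + g) = ∑ t, ω t := by
    have hb' : ∀ t, b t = a t - if t = t₀ then ε • a t₀ else 0 := by
      intro t
      by_cases ht : t = t₀
      · subst ht
        simp [hb, sub_smul]
      · simp [hb, ht]
    simp only [hb', Finset.sum_add_distrib, Finset.sum_sub_distrib, Finset.sum_ite_eq',
      Finset.mem_univ, if_true, Finset.sum_const, Finset.card_univ, Fintype.card_fin, hg]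
    rw [← Nat.cast_smul_eq_nsmul ℝ, smul_smul, mul_div_cancel₀ _ hh.ne', sub_add_cancel, ha_sum]
  have hinj : Function.Injective fun t => (m t, t) := fun t t' htt => congrArg Prod.snd htt
  refine hcore (Finset.univ.image fun t => (m t, t)) (Finset.univ_nonempty.image _)
    (Finset.card_image_le.trans (by simp)) ⟨fun c => b c.2 + g, ?_, ?_, ?_⟩
  · intro c _ j
    exact add_nonneg (hb_nonneg c.2 j) (hg_nonneg j)
  · rw [Finset.sum_image hinj.injOn, Finset.sum_image hinj.injOn]
    exact hb_sum
  · intro c hc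
    obtain ⟨t, -, rfl⟩ := Finset.mem_image.mp hc
    exact (hb_le t).trans_lt (hmono t _ _ (hb_nonneg t)
      (fun j => le_add_of_nonneg_right (hg_nonneg j)) (by simpa using hg_ne))
end

section
/- Let E = ((u_i, ω_i))_{i∈[h]} be an exchange economy with ℓ goods whose utilities are λ-Lipschitz (with respect to the Euclidean norm), and let (p, x̄) ∈ Δ × ℝ^{hℓ}_+ be an ε-Walrasian equilibrium. Then for every consumer i and every bundle y ∈ ℝ^ℓ_+ with pᵀy ≤ pᵀω_i, one has u_i(y) ≤ u_i(x̄_i) + ελ√ℓ/h; that is, u_i(x̄_i) ≥ sup{u_i(y) : y ∈ ℝ^ℓ_+, pᵀy ≤ pᵀω_i} − ελ√ℓ/h. -/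
open scoped BigOperators

/-- The coordinate sum of a vector is at most `√ℓ` times its Euclidean norm. -/
theorem sum_le_sqrt_mul_norm {ℓ : ℕ} (p : EuclideanSpace ℝ (Fin ℓ)) :
    ∑ j, p j ≤ Real.sqrt ℓ * ‖p‖ := by
  refine (le_abs_self _).trans <| abs_le_of_sq_le_sq ?_ (by positivity)
  rw [mul_pow, Real.sq_sqrt (Nat.cast_nonneg ℓ), EuclideanSpace.real_norm_sq_eq]
  simpa using sq_sum_le_card_mul_sum_sq (s := Finset.univ) (f := fun j => p j)

/-- **Approximate utility maximization at an ε-Walrasian equilibrium** (Appendix A): at an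
`ε`-Walrasian equilibrium `(p, x̄)` of an economy with `lam`-Lipschitz utilities, every
affordable bundle `y` (with `pᵀy ≤ pᵀω_i`, and such that the shifted bundle
`y − (ε√ℓ/h)·p/‖p‖` is nonnegative) gives utility at most `u_i(x̄_i) + ε lam √ℓ / h`. -/
theorem walrasian_approx_maximization
    (ℓ h : ℕ) (hh : 0 < h)
    (u : Fin h → EuclideanSpace ℝ (Fin ℓ) → ℝ)
    (ω : Fin h → EuclideanSpace ℝ (Fin ℓ))
    (hω : ∀ i j, 0 ≤ ω i j)
    (ε lam : ℝ) (hε : 0 < ε) (hlam : 0 ≤ lam)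
    -- `lam`-Lipschitz utilities on the nonnegative orthant
    (hlip : ∀ i, ∀ x y : EuclideanSpace ℝ (Fin ℓ),
      (∀ j, 0 ≤ x j) → (∀ j, 0 ≤ y j) → |u i x - u i y| ≤ lam * ‖x - y‖)
    -- the allocation `x̄` and price `p ∈ Δ`
    (xbar : Fin h → EuclideanSpace ℝ (Fin ℓ))
    (hxbar_nonneg : ∀ i j, 0 ≤ xbar i j)
    (hxbar_alloc : (∑ i, xbar i) = (∑ i, ω i))
    (p : EuclideanSpace ℝ (Fin ℓ)) (hp_nonneg : ∀ j, 0 ≤ p j) (hp_sum : (∑ j, p j) = 1)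
    -- `(p, x̄)` is an `ε`-Walrasian equilibrium
    (hW1 : ∀ i, |(∑ j, p j * xbar i j) - (∑ j, p j * ω i j)| ≤ ε)
    (hW2 : ∀ i, ∀ y : EuclideanSpace ℝ (Fin ℓ), (∀ j, 0 ≤ y j) →
      u i (xbar i) < u i y → (∑ j, p j * y j) > (∑ j, p j * ω i j) - ε / h)
    -- the weak boundary form of (ii), which follows from continuity of the utilities
    (hW2' : ∀ i, ∀ y : EuclideanSpace ℝ (Fin ℓ), (∀ j, 0 ≤ y j) →
      u i (xbar i) ≤ u i y → (∑ j, p j * y j) ≥ (∑ j, p j * ω i j) - ε / h) :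
    ∀ i, ∀ y : EuclideanSpace ℝ (Fin ℓ), (∀ j, 0 ≤ y j) →
      (∀ j, 0 ≤ y j - (ε * Real.sqrt ℓ / h) * (p j / ‖p‖)) →
      (∑ j, p j * y j) ≤ (∑ j, p j * ω i j) →
      u i y ≤ u i (xbar i) + ε * lam * Real.sqrt ℓ / h := by
  intro i y hy hshift hafford
  set c : ℝ := ε * Real.sqrt ℓ / h with hc
  have hc_nonneg : 0 ≤ c := by positivity
  have hp_ne : p ≠ 0 := by
    rintro rfl
    simp at hp_sum
  have hp_norm : ‖p‖ ≠ 0 := norm_ne_zero_iff.mpr hp_ne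
  set z : EuclideanSpace ℝ (Fin ℓ) := y - (c / ‖p‖) • p with hz
  have hz_apply (j : Fin ℓ) : z j = y j - c * (p j / ‖p‖) := by
    simp only [hz, PiLp.sub_apply, PiLp.smul_apply, smul_eq_mul]
    ring
  have hz_nonneg (j : Fin ℓ) : 0 ≤ z j := by
    rw [hz_apply]
    exact hshift j
  have hz_cost : ∑ j, p j * z j = ∑ j, p j * y j - c * ‖p‖ := by
    have hsq : ∑ j, p j * (c * (p j / ‖p‖)) = c / ‖p‖ * ‖p‖ ^ 2 := by
      rw [EuclideanSpace.real_norm_sq_eq, Finset.mul_sum]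
      exact Finset.sum_congr rfl fun j _ => by ring
    simp only [hz_apply, mul_sub, Finset.sum_sub_distrib, hsq]
    field_simp
  have hc_norm : ε / h ≤ c * ‖p‖ := by
    have h_one : 1 ≤ Real.sqrt ℓ * ‖p‖ := hp_sum ▸ sum_le_sqrt_mul_norm p
    calc ε / h = ε / h * 1 := (mul_one _).symm
      _ ≤ ε / h * (Real.sqrt ℓ * ‖p‖) := by gcongr
      _ = c * ‖p‖ := by rw [hc]; ring
  have hz_le : u i z ≤ u i (xbar i) := by
    by_contra! hlt
    have := hW2 i z hz_nonneg hlt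
    linarith
  have hyz : ‖y - z‖ = c := by
    rw [hz, sub_sub_cancel, norm_smul, norm_div, norm_norm, div_mul_cancel₀ _ hp_norm,
      Real.norm_of_nonneg hc_nonneg]
  have hdist : u i y - u i z ≤ lam * c :=
    (le_abs_self _).trans (hyz ▸ hlip i y z hy hz_nonneg)
  have hlamc : lam * c = ε * lam * Real.sqrt ℓ / h := by
    rw [hc]
    ring
  linarith
end

section
/- Let Q ⊆ ℝ^ℓ be a nonempty closed convex set that is upward closed (z ∈ Q and z' ≥ z componentwise imply z' ∈ Q), let ν ∈ ℝ^ℓ with ν ∉ Q, and let P denote the Euclidean projection of ν onto Q. Then P − ν is componentwise nonnegative and nonzero, and the vector p = (P − ν)/‖P − ν‖₁ belongs to the standard simplex Δ and satisfies pᵀν ≤ pᵀz for every z ∈ Q. -/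
open scoped BigOperators

/-- The variational inequality for a nearest point of a convex set, in coordinates. -/
theorem sum_mul_sub_nonneg_of_forall_norm_sub_le {ι : Type*} [Fintype ι]
    {Q : Set (EuclideanSpace ℝ ι)} (hQ : Convex ℝ Q) {ν P : EuclideanSpace ℝ ι} (hP : P ∈ Q)
    (hmin : ∀ z ∈ Q, ‖ν - P‖ ≤ ‖ν - z‖) {z : EuclideanSpace ℝ ι} (hz : z ∈ Q) :
    0 ≤ ∑ j, (P j - ν j) * (z j - P j) := by
  have : Nonempty Q := ⟨⟨P, hP⟩⟩
  have hinf : ‖ν - P‖ = ⨅ w : Q, ‖ν - w‖ :=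
    le_antisymm (le_ciInf fun w => hmin w w.2)
      (ciInf_le ⟨0, Set.forall_mem_range.2 fun _ => norm_nonneg _⟩ (⟨P, hP⟩ : Q))
  have h := (norm_eq_iInf_iff_real_inner_le_zero hQ hP).1 hinf z hz
  rw [← neg_nonneg, ← inner_neg_left, neg_sub, PiLp.inner_apply] at h
  simpa [mul_comm] using h

/-- **Projection yields the price vector** (Remark after Theorem 3): for a nonempty closed
convex upward-closed set `Q`, a point `ν ∉ Q`, and `P` the Euclidean projection of `ν`
onto `Q`, the vector `P − ν` is componentwise nonnegative and nonzero, and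
`p = (P − ν)/‖P − ν‖₁` lies in the standard simplex and satisfies `pᵀν ≤ pᵀz` for all
`z ∈ Q`. -/
theorem projection_price_vector
    (ℓ : ℕ) (Q : Set (EuclideanSpace ℝ (Fin ℓ)))
    (hQne : Q.Nonempty) (hQclosed : IsClosed Q) (hQconvex : Convex ℝ Q)
    (hup : ∀ z ∈ Q, ∀ z' : EuclideanSpace ℝ (Fin ℓ), (∀ j, z j ≤ z' j) → z' ∈ Q)
    (ν : EuclideanSpace ℝ (Fin ℓ)) (hν : ν ∉ Q)
    -- `P` is the Euclidean projection of `ν` onto `Q`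
    (P : EuclideanSpace ℝ (Fin ℓ)) (hPmem : P ∈ Q)
    (hPproj : ∀ z ∈ Q, ‖ν - P‖ ≤ ‖ν - z‖) :
    (∀ j, 0 ≤ P j - ν j) ∧ P - ν ≠ 0 ∧
    ∀ p : EuclideanSpace ℝ (Fin ℓ), p = (∑ j, |P j - ν j|)⁻¹ • (P - ν) →
      (∀ j, 0 ≤ p j) ∧ (∑ j, p j) = 1 ∧
      ∀ z ∈ Q, (∑ j, p j * ν j) ≤ (∑ j, p j * z j) := by
  have hVI : ∀ z ∈ Q, 0 ≤ ∑ j, (P j - ν j) * (z j - P j) := fun z hz =>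
    sum_mul_sub_nonneg_of_forall_norm_sub_le hQconvex hPmem hPproj hz
  have hnonneg : ∀ j, 0 ≤ P j - ν j := by
    intro j
    have hmem : P + EuclideanSpace.single j (1 : ℝ) ∈ Q := by
      refine hup P hPmem _ fun k => ?_
      by_cases hk : k = j <;> simp [hk]
    simpa [Pi.single_apply] using hVI _ hmem
  have hne : P - ν ≠ 0 := fun h => hν (sub_eq_zero.1 h ▸ hPmem)
  refine ⟨hnonneg, hne, ?_⟩
  rintro p rfl
  simp only [abs_of_nonneg (hnonneg _), PiLp.smul_apply, PiLp.sub_apply, smul_eq_mul]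
  have hsum : 0 ≤ ∑ j, (P j - ν j) := Finset.sum_nonneg fun j _ => hnonneg j
  refine ⟨fun j => mul_nonneg (inv_nonneg.2 hsum) (hnonneg j), ?_, fun z hz => ?_⟩
  · rw [← Finset.mul_sum]
    refine inv_mul_cancel₀ fun h => hne ?_
    ext j
    exact (Finset.sum_eq_zero_iff_of_nonneg fun j _ => hnonneg j).1 h j (Finset.mem_univ j)
  · simp only [mul_assoc, ← Finset.mul_sum]
    refine mul_le_mul_of_nonneg_left ?_ (inv_nonneg.2 hsum)
    have hsq : 0 ≤ ∑ j, (P j - ν j) * (P j - ν j) :=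
      Finset.sum_nonneg fun j _ => mul_self_nonneg _
    rw [← sub_nonneg, ← Finset.sum_sub_distrib]
    refine (add_nonneg (hVI z hz) hsq).trans_eq ?_
    rw [← Finset.sum_add_distrib]
    exact Finset.sum_congr rfl fun j _ => by ring
end
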